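/- For every real number v with 0 ≤ v ≤ 1/2 there exists an irrational θ > 1 such that ω̂̂(Λ_θ) = v. In other words, the spectrum of values of ω̂̂(Λ_θ) over irrational θ is exactly the segment [0, 1/2]. -/

import Mathlib

open Filter

/-- sup-norm of a point of `ℝ²`. -/
noncomputable def latNorm (z : ℝ × ℝ) : ℝ := max |z.1| |z.2|

/-- `Π(z) = (|z₁|·|z₂|)^(1/2)`. -/
noncomputable def latProd (z : ℝ × ℝ) : ℝ := (|z.1| * |z.2|) ^ ((1 : ℝ) / 2)

/-- The lattice `Λ_θ = {(θq − p, q + θp) : (q, p) ∈ ℤ²}`. -/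
def latticeOf (θ : ℝ) : Set (ℝ × ℝ) :=
  {z | ∃ q p : ℤ, z = (θ * (q : ℝ) - (p : ℝ), (q : ℝ) + θ * (p : ℝ))}

/-- The weak uniform Diophantine exponent of a lattice `Λ ⊆ ℝ²`:
the supremum (in `EReal`) of real `γ` such that for every sufficiently large `t`
there is a nonzero `z ∈ Λ` with `|z| ≤ t` and `Π(z) ≤ t^(−γ)`. -/
noncomputable def weakUniformExpLat (Λ : Set (ℝ × ℝ)) : EReal :=
  sSup {g : EReal | ∃ γ : ℝ, g = (γ : EReal) ∧
    ∀ᶠ t : ℝ in atTop, ∃ z ∈ Λ, z ≠ 0 ∧ latNorm z ≤ t ∧ latProd z ≤ t ^ (-γ)}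

/-- Universal bound: consecutive near-approximations have determinant zero. -/
lemma wu_universal (θ : ℝ) (hθ : Irrational θ) (N : ℕ) :
    ∃ Q : ℕ, N < Q ∧ ∀ q p : ℤ, 0 < q → q < Q →
      (1 / 2 : ℝ) * (Q : ℝ) ^ (-1 : ℝ) ≤ q * |q * θ - p| := by
  by_contra hcon
  push Not at hcon
  have h1 : ∀ n : ℕ, ∃ q p : ℤ, 0 < q ∧ q < ((N + 1 + n : ℕ) : ℤ) ∧
      |q * θ - p| < 1 / (2 * ((N : ℝ) + 1 + n)) := by
    intro n
    obtain ⟨q, p, hq, hq2, h⟩ := hcon (N + 1 + n) (by omega)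
    refine ⟨q, p, hq, hq2, ?_⟩
    have hq1 : (1 : ℝ) ≤ q := by exact_mod_cast hq
    have : |q * θ - p| ≤ q * |q * θ - p| := le_mul_of_one_le_left (abs_nonneg _) hq1
    rw [Real.rpow_neg_one] at h
    push_cast at h
    have e : (1 / 2 : ℝ) * ((N : ℝ) + 1 + n)⁻¹ = 1 / (2 * ((N : ℝ) + 1 + n)) := by
      rw [one_div, one_div, mul_inv]
    linarith
  choose q p hq hqN hqp using h1
  have hdet : ∀ n, q n * p (n + 1) = q (n + 1) * p n := by
    intro n
    have hM : (0 : ℝ) < (N : ℝ) + 1 + n := by positivity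
    have a1 := hqp n
    have a2 := hqp (n + 1)
    have b1 : (q n : ℝ) < (N : ℝ) + 1 + n := by exact_mod_cast hqN n
    have b2 : (q (n + 1) : ℝ) ≤ (N : ℝ) + 1 + n := by
      have := hqN (n + 1)
      have : q (n + 1) ≤ ((N + 1 + n : ℕ) : ℤ) := by push_cast at this ⊢; omega
      exact_mod_cast this
    have c1 : (0 : ℝ) < q n := by exact_mod_cast hq n
    have c2 : (0 : ℝ) < q (n + 1) := by exact_mod_cast hq (n + 1)
    set M : ℝ := (N : ℝ) + 1 + n with hMdef
    have a2' : |q (n + 1) * θ - p (n + 1)| < 1 / (2 * M) := by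
      refine a2.trans_le ?_
      apply one_div_le_one_div_of_le (by positivity)
      push_cast
      rw [hMdef]; linarith
    have hlt : |((q n * p (n + 1) - q (n + 1) * p n : ℤ) : ℝ)| < 1 := by
      have e : ((q n * p (n + 1) - q (n + 1) * p n : ℤ) : ℝ)
          = q (n + 1) * (q n * θ - p n) - q n * (q (n + 1) * θ - p (n + 1)) := by
        push_cast; ring
      rw [e]
      calc _ ≤ |(q (n + 1) : ℝ) * (q n * θ - p n)| + |(q n : ℝ) * (q (n + 1) * θ - p (n + 1))| :=
            abs_sub _ _
        _ = q (n + 1) * |q n * θ - p n| + q n * |q (n + 1) * θ - p (n + 1)| := by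
            rw [abs_mul, abs_mul, abs_of_pos c1, abs_of_pos c2]
        _ < M * (1 / (2 * M)) + M * (1 / (2 * M)) := by
            apply add_lt_add
            · exact mul_lt_mul' b2 a1 (abs_nonneg _) hM
            · exact mul_lt_mul' b1.le a2' (abs_nonneg _) hM
        _ = 1 := by field_simp; norm_num
    have : |q n * p (n + 1) - q (n + 1) * p n| < 1 := by exact_mod_cast hlt
    have := Int.abs_lt_one_iff.mp this
    omega
  have hr : ∀ n, (p n : ℝ) / q n = (p 0 : ℝ) / q 0 := by
    intro n
    induction n with
    | zero => rfl
    | succ n ih =>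
      rw [← ih]
      have c1 : (q n : ℝ) ≠ 0 := by exact_mod_cast (hq n).ne'
      have c2 : (q (n + 1) : ℝ) ≠ 0 := by exact_mod_cast (hq (n + 1)).ne'
      rw [div_eq_div_iff c2 c1]
      have := hdet n
      have h : (q n : ℝ) * p (n + 1) = q (n + 1) * p n := by exact_mod_cast this
      linarith
  have hpos : 0 < |θ - (p 0 : ℝ) / q 0| := by
    rw [abs_pos, sub_ne_zero]
    intro h
    apply hθ
    exact ⟨(p 0 : ℚ) / q 0, by rw [h]; push_cast; rfl⟩
  obtain ⟨n, hn⟩ := exists_nat_gt (1 / |θ - (p 0 : ℝ) / q 0|)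
  have h2 := hqp n
  have c1 : (1 : ℝ) ≤ q n := by exact_mod_cast hq n
  have h3 : |θ - (p 0 : ℝ) / q 0| ≤ |q n * θ - p n| := by
    rw [← hr n]
    have : q n * θ - p n = q n * (θ - (p n : ℝ) / q n) := by field_simp
    rw [this, abs_mul, abs_of_pos (by linarith : (0 : ℝ) < q n)]
    exact le_mul_of_one_le_left (abs_nonneg _) c1
  rw [div_lt_iff₀ hpos] at hn
  have hN : (0 : ℝ) ≤ N := by positivity
  have hn0 : (0 : ℝ) ≤ n := by positivity
  have h4 := h3.trans_lt h2
  rw [lt_div_iff₀ (by positivity)] at h4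
  nlinarith

lemma wu_prod_aux (θ : ℝ) (hθ : 1 < θ) (q p : ℤ)
    (h : |θ * q - p| ≤ |(q : ℝ) + θ * p|) : |(q : ℝ)| * |q * θ - p| ≤
      |θ * q - p| * |(q : ℝ) + θ * p| := by
  have h2 := sq_le_sq.mpr h
  have : |(q : ℝ)| ≤ |(q : ℝ) + θ * p| := by
    apply sq_le_sq.mp
    nlinarith [mul_nonneg (by nlinarith : (0 : ℝ) ≤ θ ^ 2 - 1)
      (add_nonneg (sq_nonneg (q : ℝ)) (sq_nonneg (p : ℝ))), sq_nonneg (p : ℝ)]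
  rw [mul_comm (q : ℝ) θ, mul_comm]
  exact mul_le_mul_of_nonneg_left this (abs_nonneg _)

lemma wu_upper (θ : ℝ) (hθ : 1 < θ) (β c : ℝ) (hβ : 0 ≤ β) (hc : 0 < c)
    (H : ∀ N : ℕ, ∃ Q : ℕ, N < Q ∧ ∀ q p : ℤ, 0 < q → q < Q →
      c * (Q : ℝ) ^ (-β) ≤ q * |q * θ - p|) :
    weakUniformExpLat (latticeOf θ) ≤ ((β / 2 : ℝ) : EReal) := by
  apply sSup_le
  rintro g ⟨γ, rfl, hγ⟩
  rw [EReal.coe_le_coe_iff]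
  by_contra hlt
  push Not at hlt
  have hlim : Tendsto (fun t : ℝ => t ^ (2 * γ - β)) atTop atTop :=
    tendsto_rpow_atTop (by linarith)
  have hev := (hγ.and (hlim.eventually_gt_atTop (1 / c))).and (eventually_gt_atTop (1 : ℝ))
  obtain ⟨t0, ht0⟩ := eventually_atTop.mp hev
  obtain ⟨N, hN⟩ := exists_nat_ge t0
  obtain ⟨Q, hQ, hqp⟩ := H N
  have hNQ : (N : ℝ) < Q := by exact_mod_cast hQ
  obtain ⟨⟨⟨z, ⟨q, p, rfl⟩, hz0, hzn, hzp⟩, hlarge⟩, hQ1⟩ := ht0 Q (by linarith)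
  have hQ0 : (0 : ℝ) < Q := by linarith
  simp only [latNorm, latProd] at hzn hzp
  have n1 := (le_max_left _ _).trans hzn
  have n2 := (le_max_right _ _).trans hzn
  set A := |θ * (q : ℝ) - p| * |(q : ℝ) + θ * p| with hA
  have hA0 : 0 ≤ A := by positivity
  have hAle : A ≤ (Q : ℝ) ^ (-(2 * γ)) := by
    have := pow_le_pow_left₀ (Real.rpow_nonneg hA0 _) hzp 2
    rw [← Real.rpow_natCast, ← Real.rpow_natCast, ← Real.rpow_mul hA0,
      ← Real.rpow_mul hQ0.le] at this
    norm_num at this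
    rwa [mul_comm γ 2] at this
  have hlow : (Q : ℝ) ^ (-(2 * γ)) < c * (Q : ℝ) ^ (-β) := by
    rw [div_lt_iff₀ hc] at hlarge
    have e : (Q : ℝ) ^ (-β) = (Q : ℝ) ^ (2 * γ - β) * (Q : ℝ) ^ (-(2 * γ)) := by
      rw [← Real.rpow_add hQ0]; congr 1; ring
    rw [e]
    have : 0 < (Q : ℝ) ^ (-(2 * γ)) := Real.rpow_pos_of_pos hQ0 _
    nlinarith
  have hlow1 : (Q : ℝ) ^ (-(2 * γ)) < 1 :=
    Real.rpow_lt_one_of_one_lt_of_neg hQ1 (by linarith)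
  have s1 : (θ * (q : ℝ) - p) ^ 2 ≤ (Q : ℝ) ^ 2 :=
    sq_le_sq.mpr (by rwa [abs_of_pos hQ0])
  have s2 : ((q : ℝ) + θ * p) ^ 2 ≤ (Q : ℝ) ^ 2 :=
    sq_le_sq.mpr (by rwa [abs_of_pos hQ0])
  have hqp2 : (q : ℝ) ^ 2 + (p : ℝ) ^ 2 < (Q : ℝ) ^ 2 := by
    by_contra hge
    push Not at hge
    have hθ2 : 0 < θ ^ 2 - 1 := by nlinarith
    nlinarith [mul_pos hθ2 (by positivity : (0 : ℝ) < (Q : ℝ) ^ 2),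
      mul_nonneg (by positivity : (0 : ℝ) ≤ 1 + θ ^ 2) (sub_nonneg.mpr hge)]
  have hqQ : |(q : ℝ)| < Q := by
    apply abs_lt_of_sq_lt_sq _ hQ0.le; nlinarith [sq_nonneg (p : ℝ)]
  have hpQ : |(p : ℝ)| < Q := by
    apply abs_lt_of_sq_lt_sq _ hQ0.le; nlinarith [sq_nonneg (q : ℝ)]
  have key : ∀ a b : ℤ, a ≠ 0 → |(a : ℝ)| < Q →
      c * (Q : ℝ) ^ (-β) ≤ |(a : ℝ)| * |a * θ - b| := by
    intro a b ha haQ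
    rcases lt_or_gt_of_ne ha with h | h
    · have h' : (a : ℝ) < 0 := by exact_mod_cast h
      rw [abs_of_neg h'] at haQ ⊢
      have := hqp (-a) (-b) (by omega) (by exact_mod_cast haQ)
      push_cast at this
      rwa [show -(a : ℝ) * θ - -(b : ℝ) = -(a * θ - b) by ring, abs_neg] at this
    · have h' : (0 : ℝ) < a := by exact_mod_cast h
      rw [abs_of_pos h'] at haQ ⊢
      exact hqp a b h (by exact_mod_cast haQ)
  have one_le : ∀ a : ℤ, a ≠ 0 → (1 : ℝ) ≤ |(a : ℝ)| := by
    intro a ha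
    exact_mod_cast Int.one_le_abs ha
  by_cases hq0 : q = 0
  · have hp0 : p ≠ 0 := by
      rintro rfl
      apply hz0
      simp [hq0]
    have h1 := one_le p hp0
    have : A = θ * |(p : ℝ)| * |(p : ℝ)| := by
      rw [hA, hq0]; simp [abs_mul, abs_of_pos (by linarith : 0 < θ)]; ring
    have h2 : 1 ≤ θ * |(p : ℝ)| := by nlinarith
    have h3 : 1 ≤ θ * |(p : ℝ)| * |(p : ℝ)| := one_le_mul_of_one_le_of_one_le h2 h1
    linarith
  by_cases hp0 : p = 0
  · have h1 := one_le q hq0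
    have : A = θ * |(q : ℝ)| * |(q : ℝ)| := by
      rw [hA, hp0]; simp [abs_mul, abs_of_pos (by linarith : 0 < θ)]
    have h2 : 1 ≤ θ * |(q : ℝ)| := by nlinarith
    have h3 : 1 ≤ θ * |(q : ℝ)| * |(q : ℝ)| := one_le_mul_of_one_le_of_one_le h2 h1
    linarith
  rcases le_total |θ * (q : ℝ) - p| |(q : ℝ) + θ * p| with h | h
  · have := wu_prod_aux θ hθ q p h
    have := key q p hq0 hqQ
    linarith
  · have e1 : |θ * (p : ℝ) - ((-q : ℤ) : ℝ)| = |(q : ℝ) + θ * p| := by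
      congr 1; push_cast; ring
    have e2 : |(p : ℝ) + θ * ((-q : ℤ) : ℝ)| = |θ * (q : ℝ) - p| := by
      rw [← abs_neg]; congr 1; push_cast; ring
    have := wu_prod_aux θ hθ p (-q) (by rw [e1, e2]; exact h)
    rw [e1, e2] at this
    have := key p (-q) hp0 hpQ
    rw [hA] at hAle
    linarith

lemma wu_lower (θ : ℝ) (hθ : 1 < θ) (β : ℝ) (hβ : 0 ≤ β)
    (H : ∀ᶠ T : ℝ in atTop, ∃ q p : ℤ, 0 < q ∧ (q : ℝ) ≤ T ∧ q * |q * θ - p| ≤ T ^ (-β))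
    (γ : ℝ) (hγ : γ < β / 2) :
    (γ : EReal) ≤ weakUniformExpLat (latticeOf θ) := by
  apply le_sSup
  refine ⟨γ, rfl, ?_⟩
  set K : ℝ := 1 + θ ^ 2 + θ with hK
  have hK1 : 1 < K := by nlinarith
  have hK0 : 0 < K := by linarith
  have hT : Tendsto (fun t : ℝ => t / K) atTop atTop := tendsto_id.atTop_div_const hK0
  have hlim : Tendsto (fun t : ℝ => t ^ (β - 2 * γ)) atTop atTop :=
    tendsto_rpow_atTop (by linarith)
  filter_upwards [hT.eventually H, hT.eventually_ge_atTop 1,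
    hlim.eventually_ge_atTop (K * K ^ β), eventually_gt_atTop (0 : ℝ)] with t hH hT1 hbig ht0
  obtain ⟨q, p, hq, hqT, hprod⟩ := hH
  set T := t / K with hTdef
  have hT0 : 0 < T := by linarith
  have hq1 : (1 : ℝ) ≤ q := by exact_mod_cast hq
  have htT : t = K * T := by rw [hTdef]; field_simp
  set e := q * θ - p with he
  have heT : |e| ≤ T ^ (-β) := (le_mul_of_one_le_left (abs_nonneg _) hq1).trans hprod
  have hTle : T ^ (-β) ≤ 1 := Real.rpow_le_one_of_one_le_of_nonpos hT1 (by linarith)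
  have he1 : |e| ≤ 1 := heT.trans hTle
  have z1 : θ * (q : ℝ) - p = e := by rw [he]; ring
  have z2 : |(q : ℝ) + θ * p| ≤ K * q := by
    have : (q : ℝ) + θ * p = (1 + θ ^ 2) * q - θ * e := by rw [he]; ring
    rw [this]
    have := abs_le.mp he1
    rw [abs_le, hK]
    constructor <;> nlinarith [mul_nonneg (by linarith : 0 ≤ θ) (by linarith : (0 : ℝ) ≤ q - 1)]
  refine ⟨_, ⟨q, p, rfl⟩, ?_, ?_, ?_⟩
  · intro h
    have h1 : θ * (q : ℝ) - p = 0 := congrArg Prod.fst h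
    have h2 : (q : ℝ) + θ * p = 0 := congrArg Prod.snd h
    have : (1 + θ ^ 2) * (q : ℝ) = 0 := by
      have : (p : ℝ) = θ * q := by linarith
      rw [this] at h2; linarith
    nlinarith
  · simp only [latNorm]
    rw [z1, htT]
    apply max_le
    · nlinarith
    · exact z2.trans (mul_le_mul_of_nonneg_left hqT hK0.le)
  · simp only [latProd]
    rw [z1]
    have hA : |e| * |(q : ℝ) + θ * p| ≤ t ^ (-(2 * γ)) := by
      calc |e| * |(q : ℝ) + θ * p| ≤ |e| * (K * q) :=
            mul_le_mul_of_nonneg_left z2 (abs_nonneg _)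
        _ = K * (q * |e|) := by ring
        _ ≤ K * T ^ (-β) := mul_le_mul_of_nonneg_left hprod hK0.le
        _ = K * K ^ β * t ^ (-β) := by
            rw [hTdef, Real.div_rpow ht0.le hK0.le, Real.rpow_neg hK0.le β]
            field_simp
        _ ≤ t ^ (β - 2 * γ) * t ^ (-β) :=
            mul_le_mul_of_nonneg_right hbig (Real.rpow_nonneg ht0.le _)
        _ = t ^ (-(2 * γ)) := by
            rw [← Real.rpow_add ht0]; congr 1; ring
    calc _ ≤ (t ^ (-(2 * γ))) ^ ((1 : ℝ) / 2) :=
          Real.rpow_le_rpow (by positivity) hA (by norm_num)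
      _ = t ^ (-γ) := by
          rw [← Real.rpow_mul ht0.le]; congr 1; ring

lemma wu_nonneg (θ : ℝ) : 0 ≤ weakUniformExpLat (latticeOf θ) := by
  apply le_of_forall_lt
  intro c hc
  obtain ⟨r, hr1, hr2⟩ := EReal.lt_iff_exists_real_btwn.mp hc
  refine hr1.trans_le ?_
  have hr : r < 0 := by exact_mod_cast hr2
  apply le_sSup
  refine ⟨r, rfl, ?_⟩
  have hlim : Tendsto (fun t : ℝ => t ^ (-r)) atTop atTop := tendsto_rpow_atTop (by linarith)
  filter_upwards [hlim.eventually_ge_atTop (latProd (θ, 1)),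
    eventually_ge_atTop (latNorm (θ, 1))] with t h1 h2
  refine ⟨(θ, 1), ⟨1, 0, by simp⟩, ?_, h2, h1⟩
  intro h
  have : (1 : ℝ) = 0 := congrArg Prod.snd h
  norm_num at this

lemma wu_seq (f : ℕ → ℤ → ℤ) : ∃ P Q : ℕ → ℤ, P 0 = 1 ∧ Q 0 = 0 ∧ P 1 = 1 ∧ Q 1 = 1 ∧
    (∀ k, P (k + 2) = f k (Q (k + 1)) * P (k + 1) + P k) ∧
    (∀ k, Q (k + 2) = f k (Q (k + 1)) * Q (k + 1) + Q k) := by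
  let S : ℕ → (ℤ × ℤ) × (ℤ × ℤ) := fun n => Nat.rec ((1, 0), (1, 1))
    (fun k s => (s.2, (f k s.2.2 * s.2.1 + s.1.1, f k s.2.2 * s.2.2 + s.1.2))) n
  exact ⟨fun n => (S n).1.1, fun n => (S n).1.2, rfl, rfl, rfl, rfl, fun _ => rfl, fun _ => rfl⟩

lemma wu_cf_basic (Q a : ℕ → ℤ) (hQ0 : Q 0 = 0) (hQ1 : Q 1 = 1) (ha : ∀ k, 1 ≤ a k)
    (hQ : ∀ k, Q (k + 2) = a k * Q (k + 1) + Q k) :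
    ∀ k : ℕ, 0 ≤ Q k ∧ 1 ≤ Q (k + 1) ∧ Q k ≤ Q (k + 1) ∧ (k : ℤ) ≤ Q (k + 1) := by
  intro k
  induction k with
  | zero => simp [hQ0, hQ1]
  | succ k ih =>
    obtain ⟨h1, h2, h3, h4⟩ := ih
    have h5 : Q (k + 1) ≤ a k * Q (k + 1) := le_mul_of_one_le_left (by linarith) (ha k)
    have h6 := hQ k
    refine ⟨by linarith, by linarith, by linarith, ?_⟩
    rcases Nat.eq_zero_or_pos k with rfl | hk
    · push_cast; linarith
    · have : 1 ≤ Q k := by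
        obtain ⟨j, rfl⟩ : ∃ j, k = j + 1 := ⟨k - 1, by omega⟩
        by_contra hlt
        have hz : Q (j + 1) = 0 := by omega
        rw [hz] at h6 h3 h1
        push_cast at h4
        -- Q (j+1) ≥ 1 by a direct induction
        have : ∀ i : ℕ, 1 ≤ Q (i + 1) ∧ 0 ≤ Q i := by
          intro i
          induction i with
          | zero => simp [hQ0, hQ1]
          | succ i ih =>
            have := hQ i
            have := ha i
            refine ⟨?_, by linarith⟩
            nlinarith
        have := (this j).1
        omega
      push_cast; linarith

lemma wu_cf_det (P Q a : ℕ → ℤ) (hP0 : P 0 = 1) (hQ0 : Q 0 = 0) (hQ1 : Q 1 = 1)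
    (hP : ∀ k, P (k + 2) = a k * P (k + 1) + P k)
    (hQ : ∀ k, Q (k + 2) = a k * Q (k + 1) + Q k) :
    ∀ k : ℕ, Q (k + 1) * P k - Q k * P (k + 1) = (-1) ^ k := by
  intro k
  induction k with
  | zero => simp [hP0, hQ0, hQ1]
  | succ k ih =>
    rw [hP, hQ, pow_succ, ← ih]; ring

lemma wu_cf_exists (P Q a : ℕ → ℤ) (hP0 : P 0 = 1) (hQ0 : Q 0 = 0)
    (hQ1 : Q 1 = 1) (ha : ∀ k, 1 ≤ a k)
    (hP : ∀ k, P (k + 2) = a k * P (k + 1) + P k)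
    (hQ : ∀ k, Q (k + 2) = a k * Q (k + 1) + Q k) :
    ∃ θ : ℝ, ∀ k : ℕ, (-1 : ℝ) ^ k * (Q k * θ - P k) ≤ 0 := by
  have hb := wu_cf_basic Q a hQ0 hQ1 ha hQ
  have hd := wu_cf_det P Q a hP0 hQ0 hQ1 hP hQ
  have hpos : ∀ k, (0 : ℝ) < Q (k + 1) := fun k => by
    have := (hb k).2.1
    exact_mod_cast this
  let x : ℕ → ℝ := fun n => (P (2 * n + 1) : ℝ) / Q (2 * n + 1)
  let y : ℕ → ℝ := fun n => (P (2 * n + 2) : ℝ) / Q (2 * n + 2)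
  have hx : Monotone x := by
    apply monotone_nat_of_le_succ
    intro n
    change (P (2 * n + 1) : ℝ) / Q (2 * n + 1) ≤ (P (2 * n + 2 + 1) : ℝ) / Q (2 * n + 2 + 1)
    rw [div_le_div_iff₀ (hpos _) (hpos _)]
    have h1 := hd (2 * n + 1)
    have h2 := hP (2 * n + 1)
    have h3 := hQ (2 * n + 1)
    have h4 := ha (2 * n + 1)
    rw [pow_succ, pow_mul] at h1
    norm_num at h1
    have : P (2 * n + 1) * Q (2 * n + 2 + 1) ≤ P (2 * n + 2 + 1) * Q (2 * n + 1) := by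
      have e1 : P (2 * n + 2 + 1) = a (2 * n + 1) * P (2 * n + 1 + 1) + P (2 * n + 1) := h2
      have e2 : Q (2 * n + 2 + 1) = a (2 * n + 1) * Q (2 * n + 1 + 1) + Q (2 * n + 1) := h3
      rw [e1, e2]
      linear_combination h4 + a (2 * n + 1) * h1
    exact_mod_cast this
  have hy : Antitone y := by
    apply antitone_nat_of_succ_le
    intro n
    change (P (2 * n + 3 + 1) : ℝ) / Q (2 * n + 3 + 1) ≤ (P (2 * n + 1 + 1) : ℝ) / Q (2 * n + 1 + 1)
    rw [div_le_div_iff₀ (hpos _) (hpos _)]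
    have h1 := hd (2 * n + 2)
    have h2 := hP (2 * n + 2)
    have h3 := hQ (2 * n + 2)
    have h4 := ha (2 * n + 2)
    rw [pow_add, pow_mul] at h1
    norm_num at h1
    have : P (2 * n + 3 + 1) * Q (2 * n + 1 + 1) ≤ P (2 * n + 1 + 1) * Q (2 * n + 3 + 1) := by
      have e1 : P (2 * n + 3 + 1) = a (2 * n + 2) * P (2 * n + 2 + 1) + P (2 * n + 2) := h2
      have e2 : Q (2 * n + 3 + 1) = a (2 * n + 2) * Q (2 * n + 2 + 1) + Q (2 * n + 2) := h3
      rw [e1, e2]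
      linear_combination h4 - a (2 * n + 2) * h1
    exact_mod_cast this
  have hxy : ∀ n, x n ≤ y n := by
    intro n
    change (P (2 * n + 1) : ℝ) / Q (2 * n + 1) ≤ (P (2 * n + 1 + 1) : ℝ) / Q (2 * n + 1 + 1)
    rw [div_le_div_iff₀ (hpos _) (hpos _)]
    have h1 := hd (2 * n + 1)
    rw [pow_succ, pow_mul] at h1
    norm_num at h1
    have : P (2 * n + 1) * Q (2 * n + 1 + 1) ≤ P (2 * n + 1 + 1) * Q (2 * n + 1) := by
      linear_combination h1
    exact_mod_cast this
  have hmem := hx.ciSup_mem_iInter_Icc_of_antitone hy hxy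
  refine ⟨⨆ n, x n, ?_⟩
  set θ := ⨆ n, x n
  rw [Set.mem_iInter] at hmem
  intro k
  obtain ⟨n, rfl | rfl⟩ := Nat.even_or_odd' k
  · rcases n with _ | n
    · simp [hP0, hQ0]
    · have h := (hmem n).2
      have h' : θ ≤ (P (2 * n + 1 + 1) : ℝ) / Q (2 * n + 1 + 1) := h
      rw [le_div_iff₀ (hpos _)] at h'
      rw [pow_mul]
      have e : 2 * (n + 1) = 2 * n + 1 + 1 := by ring
      rw [e]
      norm_num
      linarith
  · have h := (hmem n).1
    have h' : (P (2 * n + 1) : ℝ) / Q (2 * n + 1) ≤ θ := h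
    rw [div_le_iff₀ (hpos _)] at h'
    rw [pow_succ, pow_mul]
    norm_num
    linarith

lemma wu_cf (P Q a : ℕ → ℤ) (hP0 : P 0 = 1) (hQ0 : Q 0 = 0) (hP1 : P 1 = 1)
    (hQ1 : Q 1 = 1) (ha : ∀ k, 1 ≤ a k)
    (hP : ∀ k, P (k + 2) = a k * P (k + 1) + P k)
    (hQ : ∀ k, Q (k + 2) = a k * Q (k + 1) + Q k) :
    ∃ θ : ℝ, Irrational θ ∧ 1 < θ ∧ ∀ k : ℕ,
      |Q k * θ - P k| * Q (k + 1) ≤ 1 ∧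
      ∀ q p : ℤ, 0 < q → q < Q (k + 1) → 1 ≤ 2 * |q * θ - p| * Q (k + 1) := by
  have hb := wu_cf_basic Q a hQ0 hQ1 ha hQ
  have hd := wu_cf_det P Q a hP0 hQ0 hQ1 hP hQ
  have hpos : ∀ k, (0 : ℝ) < Q (k + 1) := fun k => by
    have := (hb k).2.1
    exact_mod_cast this
  have hnn : ∀ k, (0 : ℝ) ≤ Q k := fun k => by exact_mod_cast (hb k).1
  obtain ⟨θ, hθ⟩ := wu_cf_exists P Q a hP0 hQ0 hQ1 ha hP hQ
  have hsgn : ∀ k : ℕ, ((-1 : ℝ) ^ k) * (-1) ^ k = 1 := fun k => by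
    rw [← mul_pow]; norm_num
  have habs : ∀ k, |Q k * θ - P k| = -((-1 : ℝ) ^ k * (Q k * θ - P k)) := by
    intro k
    rw [← abs_of_nonpos (hθ k), abs_mul, abs_pow]; norm_num
  have hid : ∀ k, |Q k * θ - P k| * Q (k + 1) + |Q (k + 1) * θ - P (k + 1)| * Q k = 1 := by
    intro k
    rw [habs, habs, pow_succ]
    have h : (Q (k + 1) : ℝ) * P k - Q k * P (k + 1) = (-1) ^ k := by exact_mod_cast hd k
    linear_combination (-1 : ℝ) ^ k * h + hsgn k
  have hdec : ∀ k, |Q (k + 1) * θ - P (k + 1)| ≤ |Q k * θ - P k| := by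
    intro k
    have h1 : |Q k * θ - P k| = |Q (k + 2) * θ - P (k + 2)|
        + a k * |Q (k + 1) * θ - P (k + 1)| := by
      rw [habs, habs, habs, hP, hQ, pow_succ, pow_succ]
      push_cast
      ring
    have h2 : (1 : ℝ) ≤ a k := by exact_mod_cast ha k
    have h3 := le_mul_of_one_le_left (abs_nonneg (Q (k + 1) * θ - P (k + 1))) h2
    have h4 := abs_nonneg (Q (k + 2) * θ - P (k + 2))
    linarith
  have hup : ∀ k, |Q k * θ - P k| * Q (k + 1) ≤ 1 := by
    intro k
    have := hid k
    have := mul_nonneg (abs_nonneg (Q (k + 1) * θ - P (k + 1))) (hnn k)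
    linarith
  have hlo : ∀ k, 1 ≤ 2 * |Q k * θ - P k| * Q (k + 1) := by
    intro k
    have h1 := hid k
    have h2 : (Q k : ℝ) ≤ Q (k + 1) := by exact_mod_cast (hb k).2.2.1
    have := mul_le_mul (hdec k) h2 (hnn k) (abs_nonneg _)
    linarith
  have hbest : ∀ k : ℕ, ∀ q p : ℤ, 0 < q → q < Q (k + 1) →
      |Q k * θ - P k| ≤ |q * θ - p| := by
    intro k q p hq hqQ
    have hz : ((-1 : ℤ) ^ k) * (-1) ^ k = 1 := by rw [← mul_pow]; norm_num
    obtain ⟨x, hx⟩ : ∃ x : ℤ, x = (-1) ^ k * (Q (k + 1) * p - P (k + 1) * q) := ⟨_, rfl⟩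
    obtain ⟨y, hy⟩ : ∃ y : ℤ, y = (-1) ^ k * (q * P k - p * Q k) := ⟨_, rfl⟩
    have h := hd k
    have eq1 : q = x * Q k + y * Q (k + 1) := by
      rw [hx, hy]
      linear_combination (-q) * hz - (-1) ^ k * q * h
    have eq2 : p = x * P k + y * P (k + 1) := by
      rw [hx, hy]
      linear_combination (-p) * hz - (-1) ^ k * p * h
    have hr : (-1 : ℝ) ^ k * (q * θ - p) =
        -(x * |Q k * θ - P k|) + y * |Q (k + 1) * θ - P (k + 1)| := by
      rw [habs, habs, eq1, eq2, pow_succ]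
      push_cast
      ring
    have habs2 : |q * θ - p| = |(-1 : ℝ) ^ k * (q * θ - p)| := by
      rw [abs_mul, abs_pow]; norm_num
    rw [habs2, hr]
    set u := |Q k * θ - P k|
    set v := |Q (k + 1) * θ - P (k + 1)|
    have hu : 0 ≤ u := abs_nonneg _
    have hv : 0 ≤ v := abs_nonneg _
    obtain ⟨b1, b2, b3, -⟩ := hb k
    rcases lt_trichotomy x 0 with hx0 | hx0 | hx0
    · have hy1 : 0 ≤ y := by
        by_contra hneg
        push Not at hneg
        nlinarith
      have hx' : (x : ℝ) ≤ -1 := by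
        have : x ≤ -1 := by omega
        exact_mod_cast this
      have hy' : (0 : ℝ) ≤ y := by exact_mod_cast hy1
      refine le_trans ?_ (le_abs_self _)
      nlinarith [mul_nonneg hy' hv]
    · exfalso
      rw [hx0] at eq1
      have : 0 < y := by
        by_contra hneg
        push Not at hneg
        nlinarith
      nlinarith
    · have hy1 : y ≤ 0 := by
        by_contra hneg
        push Not at hneg
        nlinarith
      have hx' : (1 : ℝ) ≤ x := by exact_mod_cast hx0
      have hy' : (y : ℝ) ≤ 0 := by exact_mod_cast hy1
      refine le_trans ?_ (neg_le_abs _)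
      nlinarith [mul_nonneg (neg_nonneg.mpr hy') hv]
  have hlo2 : ∀ k : ℕ, ∀ q p : ℤ, 0 < q → q < Q (k + 1) → 1 ≤ 2 * |q * θ - p| * Q (k + 1) := by
    intro k q p hq hqQ
    have h1 := hbest k q p hq hqQ
    have h2 := mul_le_mul_of_nonneg_right h1 (hpos k).le
    have := hlo k
    linarith
  have hirr : Irrational θ := by
    rintro ⟨r, hr⟩
    obtain ⟨n, hn⟩ : ∃ n : ℕ, (r.den : ℤ) < Q (n + 1) := by
      refine ⟨r.den + 1, ?_⟩
      have := (hb (r.den + 1)).2.2.2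
      push_cast at this
      linarith
    have h := hlo2 n r.den r.num (by exact_mod_cast r.den_pos) hn
    have : ((r.den : ℤ) : ℝ) * θ - (r.num : ℝ) = 0 := by
      rw [← hr]
      have : (r.den : ℚ) * r = r.num := Rat.den_mul_eq_num r
      have : ((r.den : ℚ) * r : ℝ) = r.num := by exact_mod_cast this
      push_cast at this ⊢
      linarith
    rw [this] at h
    norm_num at h
  refine ⟨θ, hirr, ?_, fun k => ⟨hup k, hlo2 k⟩⟩
  have h1 := hθ 1
  rw [hP1, hQ1] at h1
  norm_num at h1
  refine lt_of_le_of_ne h1 ?_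
  intro h
  exact hirr.ne_one h.symm

lemma wu_step (b : ℝ) (hb0 : 0 ≤ b) (hb1 : b < 1) (R R' S : ℝ) (hR : 1 ≤ R) (hR' : R' ≤ R)
    (hR'0 : 0 ≤ R') (hS : S = (⌈R ^ (b / (1 - b))⌉ : ℝ) * R + R') :
    R ≤ S * S ^ (-b) ∧ S * S ^ (-b) ≤ 3 * R := by
  have h1b : 0 < 1 - b := by linarith
  have hR0 : 0 < R := by linarith
  set w := R ^ (b / (1 - b)) with hw
  have hw1 : 1 ≤ w := Real.one_le_rpow hR (by positivity)
  have hwR : w * R = R ^ (1 / (1 - b)) := by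
    rw [hw]
    nth_rewrite 2 [← Real.rpow_one R]
    rw [← Real.rpow_add hR0]
    congr 1
    field_simp
    ring
  have c1 := Int.le_ceil w
  have c2 := Int.ceil_lt_add_one w
  have hlow : R ^ (1 / (1 - b)) ≤ S := by
    rw [← hwR, hS]; nlinarith
  have hhigh : S ≤ 3 * R ^ (1 / (1 - b)) := by
    rw [← hwR, hS]; nlinarith
  have hp : 0 < R ^ (1 / (1 - b)) := Real.rpow_pos_of_pos hR0 _
  have hS0 : 0 < S := by linarith
  have e : S * S ^ (-b) = S ^ (1 - b) := by
    rw [sub_eq_add_neg, Real.rpow_add hS0, Real.rpow_one]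
  have e2 : (R ^ (1 / (1 - b))) ^ (1 - b) = R := by
    rw [← Real.rpow_mul hR0.le, one_div_mul_cancel h1b.ne', Real.rpow_one]
  rw [e]
  constructor
  · have := Real.rpow_le_rpow hp.le hlow h1b.le
    rwa [e2] at this
  · have := Real.rpow_le_rpow hS0.le hhigh h1b.le
    rw [Real.mul_rpow (by norm_num) hp.le, e2] at this
    refine this.trans ?_
    apply mul_le_mul_of_nonneg_right _ hR0.le
    calc (3 : ℝ) ^ (1 - b) ≤ 3 ^ (1 : ℝ) :=
          Real.rpow_le_rpow_of_exponent_le (by norm_num) (by linarith)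
      _ = 3 := Real.rpow_one _

lemma wu_locate (Q : ℕ → ℤ) (hQ1 : Q 1 = 1) (q : ℤ) (hq : 0 < q) (k : ℕ) (hk : q < Q (k + 1)) :
    ∃ j, j < k ∧ Q (j + 1) ≤ q ∧ q < Q (j + 2) := by
  induction k with
  | zero => rw [hQ1] at hk; omega
  | succ k ih =>
    by_cases h : q < Q (k + 1)
    · obtain ⟨j, h1, h2⟩ := ih h
      exact ⟨j, by omega, h2⟩
    · exact ⟨k, by omega, by omega, hk⟩

lemma wu_exists (β : ℝ) (hβ0 : 0 ≤ β) (hβ1 : β ≤ 1) :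
    ∃ θ : ℝ, Irrational θ ∧ 1 < θ ∧
      weakUniformExpLat (latticeOf θ) = ((β / 2 : ℝ) : EReal) := by
  let b : ℕ → ℝ := fun k => min β ((k : ℝ) / (k + 1))
  have hbβ : ∀ k, b k ≤ β := fun k => min_le_left _ _
  have hb0 : ∀ k, 0 ≤ b k := fun k => le_min hβ0 (by positivity)
  have hb1 : ∀ k, b k < 1 := fun k => (min_le_right _ _).trans_lt (by
    rw [div_lt_one (by positivity)]; linarith)
  obtain ⟨P, Q, hP0, hQ0, hP1, hQ1, hP, hQ⟩ :=
    wu_seq (fun k x => max 1 ⌈(x : ℝ) ^ (b k / (1 - b k))⌉)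
  have hb := wu_cf_basic Q (fun k => max 1 ⌈(Q (k + 1) : ℝ) ^ (b k / (1 - b k))⌉)
    hQ0 hQ1 (fun k => le_max_left _ _) hQ
  obtain ⟨θ, hirr, hθ1, hcf⟩ := wu_cf P Q
    (fun k => max 1 ⌈(Q (k + 1) : ℝ) ^ (b k / (1 - b k))⌉) hP0 hQ0 hP1 hQ1
    (fun k => le_max_left _ _) hP hQ
  have hR1 : ∀ k, (1 : ℝ) ≤ Q (k + 1) := fun k => by exact_mod_cast (hb k).2.1
  have hmono : Monotone Q := monotone_nat_of_le_succ fun k => (hb k).2.2.1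
  have hstep : ∀ k, (Q (k + 1) : ℝ) ≤ Q (k + 2) * (Q (k + 2) : ℝ) ^ (-b k) ∧
      Q (k + 2) * (Q (k + 2) : ℝ) ^ (-b k) ≤ 3 * (Q (k + 1) : ℝ) := by
    intro k
    apply wu_step (b k) (hb0 k) (hb1 k) (Q (k + 1)) (Q k) (Q (k + 2)) (hR1 k)
    · exact_mod_cast (hb k).2.2.1
    · exact_mod_cast (hb k).1
    · rw [hQ k, max_eq_right]
      · push_cast; rfl
      · rw [Int.one_le_ceil_iff]
        have := hR1 k
        positivity
  refine ⟨θ, hirr, hθ1, le_antisymm ?_ ?_⟩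
  · rcases hβ1.eq_or_lt with rfl | hβlt
    · exact wu_upper θ hθ1 1 (1 / 2) hβ0 (by norm_num) (wu_universal θ hirr)
    · apply wu_upper θ hθ1 β (1 / 6) hβ0 (by norm_num)
      intro N
      have hN : ((N + 1 : ℕ) : ℤ) ≤ Q (N + 2) := (hb (N + 1)).2.2.2
      refine ⟨(Q (N + 2)).toNat, by omega, ?_⟩
      have hcast : (((Q (N + 2)).toNat : ℕ) : ℤ) = Q (N + 2) := Int.toNat_of_nonneg (by omega)
      have hcastR : (((Q (N + 2)).toNat : ℕ) : ℝ) = Q (N + 2) := by exact_mod_cast hcast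
      rw [hcast, hcastR]
      intro q p hq hqQ
      obtain ⟨j, hj, hj1, hj2⟩ := wu_locate Q hQ1 q hq (N + 1) hqQ
      have h1 := (hcf (j + 1)).2 q p hq hj2
      have h2 := (hstep j).2
      have hqR : (Q (j + 1) : ℝ) ≤ q := by exact_mod_cast hj1
      have hS : (1 : ℝ) ≤ Q (j + 2) := hR1 (j + 1)
      have hSQ : (Q (j + 2) : ℝ) ≤ Q (N + 2) := by exact_mod_cast hmono (by omega)
      have h3 : (Q (N + 2) : ℝ) ^ (-β) ≤ (Q (j + 2) : ℝ) ^ (-b j) :=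
        calc (Q (N + 2) : ℝ) ^ (-β) ≤ (Q (j + 2) : ℝ) ^ (-β) :=
              Real.rpow_le_rpow_of_nonpos (by linarith) hSQ (by linarith)
          _ ≤ _ := Real.rpow_le_rpow_of_exponent_le hS (by linarith [hbβ j])
      refine le_trans (mul_le_mul_of_nonneg_left h3 (by norm_num)) ?_
      set S : ℝ := (Q (j + 2) : ℝ)
      set X : ℝ := S ^ (-b j)
      set e : ℝ := |q * θ - p|
      have he : 0 ≤ e := abs_nonneg _
      have h1' : 1 ≤ 2 * e * S := h1
      have hS0 : 0 < S := by linarith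
      have hX : 0 ≤ X := Real.rpow_nonneg hS0.le _
      have h4 : X ≤ X * (2 * e * S) := le_mul_of_one_le_right hX h1'
      have h5 : (2 * e) * (S * X) ≤ (2 * e) * (3 * q) :=
        mul_le_mul_of_nonneg_left (by linarith) (by linarith)
      linarith
  · apply le_of_forall_lt
    intro c hc
    obtain ⟨r, hr1, hr2⟩ := EReal.lt_iff_exists_real_btwn.mp hc
    refine hr1.trans_le ?_
    have hr : r < β / 2 := by exact_mod_cast hr2
    rcases lt_or_ge r 0 with hneg | hr0
    · exact le_trans (by exact_mod_cast hneg.le) (wu_nonneg θ)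
    obtain ⟨B, hB1, hB2⟩ := exists_between (by linarith : 2 * r < β)
    apply wu_lower θ hθ1 B (by linarith) _ r (by linarith)
    have hbt : ∀ᶠ k : ℕ in atTop, B ≤ b k := by
      have hlim : Tendsto (fun k : ℕ => (k : ℝ) / ((k : ℝ) + 1)) atTop (nhds 1) :=
        tendsto_natCast_div_add_atTop 1
      filter_upwards [hlim.eventually (eventually_ge_nhds (by linarith : B < 1))] with k hk
      exact le_min hB2.le hk
    obtain ⟨k0, hk0⟩ := eventually_atTop.mp hbt
    filter_upwards [eventually_ge_atTop (Q (k0 + 1) : ℝ)] with T hT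
    have hT1 : 1 ≤ T := (hR1 k0).trans hT
    have hfl : 0 < ⌊T⌋ := Int.floor_pos.mpr hT1
    obtain ⟨k, hk⟩ : ∃ k : ℕ, ⌊T⌋ < Q (k + 1) := by
      refine ⟨⌊T⌋.toNat + 1, ?_⟩
      have := (hb (⌊T⌋.toNat + 1)).2.2.2
      omega
    obtain ⟨j, hj, hj1, hj2⟩ := wu_locate Q hQ1 _ hfl k hk
    have hjk : k0 ≤ j := by
      by_contra hlt
      have h1 : Q (j + 2) ≤ Q (k0 + 1) := hmono (by omega)
      have h2 : Q (k0 + 1) ≤ ⌊T⌋ := Int.le_floor.mpr hT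
      omega
    have hTS : T < Q (j + 2) := Int.floor_lt.mp hj2
    refine ⟨Q (j + 1), P (j + 1), by linarith [(hb j).2.1], Int.le_floor.mp hj1, ?_⟩
    have h1 : |Q (j + 1) * θ - P (j + 1)| * Q (j + 2) ≤ 1 := (hcf (j + 1)).1
    have h2 := (hstep j).1
    have h3 : (Q (j + 2) : ℝ) ^ (-b j) ≤ T ^ (-B) :=
      calc (Q (j + 2) : ℝ) ^ (-b j) ≤ T ^ (-b j) :=
            Real.rpow_le_rpow_of_nonpos (by linarith) hTS.le (by linarith [hb0 j])
        _ ≤ _ := Real.rpow_le_rpow_of_exponent_le hT1 (by linarith [hk0 j hjk])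
    refine le_trans ?_ h3
    set S : ℝ := (Q (j + 2) : ℝ)
    set X : ℝ := S ^ (-b j)
    set e : ℝ := |Q (j + 1) * θ - P (j + 1)|
    have he : 0 ≤ e := abs_nonneg _
    have hX : 0 ≤ X := Real.rpow_nonneg (by linarith) _
    calc Q (j + 1) * e ≤ (S * X) * e := mul_le_mul_of_nonneg_right h2 he
      _ = X * (e * S) := by ring
      _ ≤ X := mul_le_of_le_one_right hX h1

/-- The spectrum of `ω̂̂(Λ_θ)` over irrational `θ > 1` is exactly the segment
`[0, 1/2]`: for every real `v ∈ [0, 1/2]` there is an irrational `θ > 1` with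
`ω̂̂(Λ_θ) = v`, and conversely. -/
theorem weakUniformExpLat_spectrum :
    {v : EReal | ∃ θ : ℝ, Irrational θ ∧ 1 < θ ∧ weakUniformExpLat (latticeOf θ) = v} =
      Set.Icc (0 : EReal) ((1 / 2 : ℝ) : EReal) := by
  ext v
  simp only [Set.mem_ofPred_eq, Set.mem_Icc]
  constructor
  · rintro ⟨θ, hirr, hθ, rfl⟩
    exact ⟨wu_nonneg θ,
      wu_upper θ hθ 1 (1 / 2) (by norm_num) (by norm_num) (wu_universal θ hirr)⟩
  · rintro ⟨h0, h1⟩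
    lift v to ℝ using ⟨fun h => by simp [h] at h1, fun h => by simp [h] at h0⟩
    have h0' : 0 ≤ v := by exact_mod_cast h0
    have h1' : v ≤ 1 / 2 := EReal.coe_le_coe_iff.mp h1
    obtain ⟨θ, hirr, hθ, h⟩ := wu_exists (2 * v) (by linarith) (by linarith)
    refine ⟨θ, hirr, hθ, ?_⟩
    rw [h]
    congr 1
    ring
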